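/- arXiv:2405.00756 — 2 statements merged into one kernel-verified Lean document; each statement's English description precedes it below -/
import Mathlib

section
/- Let λ be a partition and n ≥ n_λ := |λ| + λ_1; set λ^{(m)} := (m−|λ|, λ_1,…,λ_r) for m ∈ {n, n+1}, and let □_0 be the unique box of the skew diagram λ^{(n+1)}/λ^{(n)}. Define the linear map 𝔮 : V_{λ^{(n+1)}} → V_{λ^{(n)}} on basis elements by 𝔮(e_τ) = e_{τ|_{λ^{(n)}}} if τ(□_0) = n+1, and 𝔮(e_τ) = 0 otherwise. Then 𝔮 ∘ T_i = T_i ∘ 𝔮 for all 1 ≤ i ≤ n−1, where the operators T_i act on V_{λ^{(n+1)}} and on V_{λ^{(n)}} by the explicit seminormal formulas. -/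
open scoped Classical

/-- The content of a box `(i, j)` (row `i`, column `j`, both 0-indexed): `c(□) = j - i`. -/
def content (c : ℕ × ℕ) : ℤ := (c.2 : ℤ) - (c.1 : ℤ)

/-- `τ` is a standard Young tableau on the finite cell set `s`: a bijective labelling of
the boxes by `1, …, s.card`, strictly increasing along rows and columns (normalized to
`0` off `s`). -/
def IsSYT (s : Finset (ℕ × ℕ)) (τ : ℕ × ℕ → ℕ) : Prop :=
  (∀ j, 1 ≤ j → j ≤ s.card → ∃! c, c ∈ s ∧ τ c = j) ∧
  (∀ c ∈ s, ∀ c' ∈ s, c.1 = c'.1 → c.2 + 1 = c'.2 → τ c < τ c') ∧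
  (∀ c ∈ s, ∀ c' ∈ s, c.1 + 1 = c'.1 → c.2 = c'.2 → τ c < τ c') ∧
  (∀ c, c ∉ s → τ c = 0)

/-- The type of standard Young tableaux on `s`. -/
abbrev SYTt (s : Finset (ℕ × ℕ)) : Type := {τ : ℕ × ℕ → ℕ // IsSYT s τ}

/-- The (unique) box of `s` labelled `j` by the tableau `τ`. -/
noncomputable def theBoxS (s : Finset (ℕ × ℕ)) (τ : ℕ × ℕ → ℕ) (j : ℕ) : ℕ × ℕ :=
  if h : ∃ c, c ∈ s ∧ τ c = j then h.choose else (0, 0)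

/-- The labelling obtained from `τ` by exchanging the labels `i` and `i + 1`. -/
def swapS (τ : ℕ × ℕ → ℕ) (i : ℕ) : ℕ × ℕ → ℕ :=
  fun c => if τ c = i then i + 1 else if τ c = i + 1 then i else τ c

/-- The field `ℚ(t)`. -/
abbrev Qt : Type := RatFunc ℚ

/-- The variable `t ∈ ℚ(t)`. -/
noncomputable def tV : Qt := RatFunc.X

/-- The `ℚ(t)`-vector space `V_λ` with basis `{e_τ : τ ∈ SYT(λ)}`. -/
abbrev Vsp (s : Finset (ℕ × ℕ)) : Type := SYTt s →₀ Qt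

/-- The image of the basis vector `e_τ` under the seminormal operator `T_i`:
`T_i e_τ = e_τ` if `i, i+1` are in the same row of `τ`; `T_i e_τ = −t e_τ` if they are in
the same column; `T_i e_τ = e_{s_i(τ)} + ((1−t)t^{c_τ(i)}/(t^{c_τ(i)} − t^{c_τ(i+1)})) e_τ`
if `s_i(τ) > τ` (i.e. `c_τ(i) − c_τ(i+1) > 1`); and
`T_i e_τ = −((t^{c_τ(i+1)+1} − t^{c_τ(i)})(t^{c_τ(i)+1} − t^{c_τ(i+1)})/(t^{c_τ(i+1)} −
t^{c_τ(i)})²) e_{s_i(τ)} + ((1−t)t^{c_τ(i)}/(t^{c_τ(i)} − t^{c_τ(i+1)})) e_τ` if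
`s_i(τ) < τ`. -/
noncomputable def Tact (s : Finset (ℕ × ℕ)) (i : ℕ) (τ : SYTt s) : Vsp s :=
  let b1 := theBoxS s τ.1 i
  let b2 := theBoxS s τ.1 (i + 1)
  let c1 := content b1
  let c2 := content b2
  if b1.1 = b2.1 then Finsupp.single τ 1
  else if b1.2 = b2.2 then Finsupp.single τ (-tV)
  else if h : IsSYT s (swapS τ.1 i) then
    (if 1 < c1 - c2 then
      Finsupp.single (⟨swapS τ.1 i, h⟩ : SYTt s) 1 +
        Finsupp.single τ ((1 - tV) * tV ^ c1 / (tV ^ c1 - tV ^ c2))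
    else
      Finsupp.single (⟨swapS τ.1 i, h⟩ : SYTt s)
          (-((tV ^ (c2 + 1) - tV ^ c1) * (tV ^ (c1 + 1) - tV ^ c2) /
            (tV ^ c2 - tV ^ c1) ^ 2)) +
        Finsupp.single τ ((1 - tV) * tV ^ c1 / (tV ^ c1 - tV ^ c2)))
  else 0

/-- The seminormal operator `T_i` on `V_λ`, as a linear endomorphism. -/
noncomputable def heckeT (s : Finset (ℕ × ℕ)) (i : ℕ) : Module.End Qt (Vsp s) :=
  Finsupp.lift (Vsp s) Qt (SYTt s) (Tact s i)

/-- The cell set of the padded partition `λ^{(m)} = (m − |λ|, λ₁, …, λ_r)`: a first row of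
length `m − |λ|`, atop a copy of `λ` shifted down by one row. -/
def hatCells (μ : YoungDiagram) (m : ℕ) : Finset (ℕ × ℕ) :=
  ((Finset.range (m - μ.card)).image fun j => (0, j)) ∪
    (μ.cells.image fun c => (c.1 + 1, c.2))

/-- The image of the basis vector `e_τ`, `τ ∈ SYT(λ^{(n+1)})`, under the map
`𝔮 : V_{λ^{(n+1)}} → V_{λ^{(n)}}`: it is `e_{τ|_{λ^{(n)}}}` if the box
`□₀ = λ^{(n+1)}/λ^{(n)}` carries the label `n + 1`, and `0` otherwise. -/
noncomputable def qact (μ : YoungDiagram) (n : ℕ) (τ : SYTt (hatCells μ (n + 1))) :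
    Vsp (hatCells μ n) :=
  if τ.1 (0, n - μ.card) = n + 1 then
    (if h : IsSYT (hatCells μ n) (fun c => if c = (0, n - μ.card) then 0 else τ.1 c) then
      Finsupp.single (⟨fun c => if c = (0, n - μ.card) then 0 else τ.1 c, h⟩ :
        SYTt (hatCells μ n)) (1 : Qt)
    else 0)
  else 0

/-- The linear map `𝔮 : V_{λ^{(n+1)}} → V_{λ^{(n)}}`. -/
noncomputable def qmap (μ : YoungDiagram) (n : ℕ) :
    Vsp (hatCells μ (n + 1)) →ₗ[Qt] Vsp (hatCells μ n) :=
  Finsupp.lift (Vsp (hatCells μ n)) Qt (SYTt (hatCells μ (n + 1))) (qact μ n)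

/-- The labels of a standard Young tableau on `s` are exactly `1, …, s.card`. -/
theorem IsSYT.image_eq {s : Finset (ℕ × ℕ)} {τ : ℕ × ℕ → ℕ} (h : IsSYT s τ) :
    s.image τ = Finset.Icc 1 s.card := by
  symm
  apply Finset.eq_of_subset_of_card_le
  · intro j hj
    rw [Finset.mem_Icc] at hj
    obtain ⟨c, hc, -⟩ := h.1 j hj.1 hj.2
    exact Finset.mem_image.2 ⟨c, hc⟩
  · simpa using Finset.card_image_le

theorem IsSYT.label_mem {s : Finset (ℕ × ℕ)} {τ : ℕ × ℕ → ℕ} (h : IsSYT s τ) {c : ℕ × ℕ}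
    (hc : c ∈ s) : 1 ≤ τ c ∧ τ c ≤ s.card := by
  rw [← Finset.mem_Icc, ← h.image_eq]
  exact Finset.mem_image_of_mem τ hc

theorem IsSYT.injOn {s : Finset (ℕ × ℕ)} {τ : ℕ × ℕ → ℕ} (h : IsSYT s τ) {c c' : ℕ × ℕ}
    (hc : c ∈ s) (hc' : c' ∈ s) (hcc' : τ c = τ c') : c = c' :=
  (h.1 (τ c) (h.label_mem hc).1 (h.label_mem hc).2).unique ⟨hc, rfl⟩ ⟨hc', hcc'.symm⟩

theorem IsSYT.theBoxS_label {s : Finset (ℕ × ℕ)} {τ : ℕ × ℕ → ℕ} (h : IsSYT s τ)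
    {c : ℕ × ℕ} (hc : c ∈ s) : theBoxS s τ (τ c) = c := by
  have hex : ∃ d, d ∈ s ∧ τ d = τ c := ⟨c, hc, rfl⟩
  rw [theBoxS, dif_pos hex]
  exact h.injOn hex.choose_spec.1 hc hex.choose_spec.2

/-- The labelling `τ` with the label of the box `b` removed. -/
def eraseBox (b : ℕ × ℕ) (τ : ℕ × ℕ → ℕ) : ℕ × ℕ → ℕ :=
  fun c => if c = b then 0 else τ c

theorem eraseBox_self (b : ℕ × ℕ) (τ : ℕ × ℕ → ℕ) : eraseBox b τ b = 0 := if_pos rfl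

theorem eraseBox_of_ne {b c : ℕ × ℕ} (τ : ℕ × ℕ → ℕ) (h : c ≠ b) : eraseBox b τ c = τ c :=
  if_neg h

theorem eraseBox_swapS (b : ℕ × ℕ) (τ : ℕ × ℕ → ℕ) {i : ℕ} (hi : 1 ≤ i) :
    eraseBox b (swapS τ i) = swapS (eraseBox b τ) i := by
  funext c
  unfold eraseBox swapS
  by_cases hc : c = b
  · simp only [if_pos hc]
    rw [if_neg (by omega), if_neg (by omega)]
  · simp only [if_neg hc]

theorem swapS_eq_iff (τ : ℕ × ℕ → ℕ) {i m : ℕ} (him : i + 1 < m) (c : ℕ × ℕ) :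
    swapS τ i c = m ↔ τ c = m := by
  unfold swapS
  split_ifs <;> omega

section InsertBox

variable {s s' : Finset (ℕ × ℕ)} {b : ℕ × ℕ} {τ : ℕ × ℕ → ℕ}

/-- Removing the box with the largest label of a standard Young tableau leaves a standard
Young tableau. -/
theorem IsSYT.eraseBox (hs' : s' = insert b s) (hb : b ∉ s) (h : IsSYT s' τ)
    (hτ : τ b = s.card + 1) : IsSYT s (eraseBox b τ) := by
  subst hs'
  have hne : ∀ c ∈ s, c ≠ b := fun c hc hcb => hb (hcb ▸ hc)
  have hval : ∀ c ∈ s, _root_.eraseBox b τ c = τ c := fun c hc => eraseBox_of_ne τ (hne c hc)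
  have hcard := Finset.card_insert_of_notMem hb
  refine ⟨fun j hj hjs => ?_, fun c hc c' hc' => ?_, fun c hc c' hc' => ?_, fun c hc => ?_⟩
  · obtain ⟨c, ⟨hc, hcj⟩, -⟩ := h.1 j hj (by omega)
    have hcs : c ∈ s := by
      rcases Finset.mem_insert.1 hc with rfl | hc
      · omega
      · exact hc
    refine ⟨c, ⟨hcs, by rw [hval c hcs, hcj]⟩, fun d hd => ?_⟩
    exact h.injOn (Finset.mem_insert_of_mem hd.1) hc (by rw [← hval d hd.1, hd.2, hcj])
  · rw [hval c hc, hval c' hc']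
    exact h.2.1 c (Finset.mem_insert_of_mem hc) c' (Finset.mem_insert_of_mem hc')
  · rw [hval c hc, hval c' hc']
    exact h.2.2.1 c (Finset.mem_insert_of_mem hc) c' (Finset.mem_insert_of_mem hc')
  · by_cases hcb : c = b
    · rw [hcb, eraseBox_self]
    · rw [eraseBox_of_ne τ hcb]
      exact h.2.2.2 c (by simp [hcb, hc])

/-- A labelling whose largest label lies in a box `b` that has no box of `s` to its right or
below it is a standard Young tableau if its restriction to the other boxes is one. -/
theorem IsSYT.of_eraseBox (hs' : s' = insert b s) (hb : b ∉ s)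
    (hright : (b.1, b.2 + 1) ∉ s) (hbelow : (b.1 + 1, b.2) ∉ s)
    (h : IsSYT s (_root_.eraseBox b τ)) (hτ : τ b = s.card + 1) : IsSYT s' τ := by
  subst hs'
  have hne : ∀ c ∈ s, c ≠ b := fun c hc hcb => hb (hcb ▸ hc)
  have hval : ∀ c ∈ s, _root_.eraseBox b τ c = τ c := fun c hc => eraseBox_of_ne τ (hne c hc)
  have hlt : ∀ c ∈ s, τ c < τ b := fun c hc => by
    have := (h.label_mem hc).2
    rw [hval c hc] at this
    omega
  have hcard := Finset.card_insert_of_notMem hb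
  refine ⟨fun j hj hjs => ?_, fun c hc c' hc' h₁ h₂ => ?_, fun c hc c' hc' h₁ h₂ => ?_,
    fun c hc => ?_⟩
  · by_cases hjn : j = s.card + 1
    · refine ⟨b, ⟨Finset.mem_insert_self b s, by omega⟩, fun d hd => ?_⟩
      rcases Finset.mem_insert.1 hd.1 with hdb | hds
      · exact hdb
      · have := hlt d hds
        have := hd.2
        omega
    · obtain ⟨c, ⟨hc, hcj⟩, -⟩ := h.1 j hj (by omega)
      refine ⟨c, ⟨Finset.mem_insert_of_mem hc, by rw [← hval c hc, hcj]⟩, fun d hd => ?_⟩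
      rcases Finset.mem_insert.1 hd.1 with hdb | hds
      · have := hd.2
        rw [hdb] at this
        omega
      · exact h.injOn hds hc (by rw [hval d hds, hd.2, hcj])
  · rcases Finset.mem_insert.1 hc with rfl | hcs <;> rcases Finset.mem_insert.1 hc' with rfl | hcs'
    · omega
    · exact absurd (by rwa [h₁, h₂]) hright
    · exact hlt c hcs
    · rw [← hval c hcs, ← hval c' hcs']
      exact h.2.1 c hcs c' hcs' h₁ h₂
  · rcases Finset.mem_insert.1 hc with rfl | hcs <;> rcases Finset.mem_insert.1 hc' with rfl | hcs'
    · omega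
    · exact absurd (by rwa [h₁, h₂]) hbelow
    · exact hlt c hcs
    · rw [← hval c hcs, ← hval c' hcs']
      exact h.2.2.1 c hcs c' hcs' h₁ h₂
  · rw [Finset.mem_insert, not_or] at hc
    rw [← eraseBox_of_ne τ hc.1]
    exact h.2.2.2 c hc.2

theorem isSYT_swapS_iff_eraseBox (hs' : s' = insert b s) (hb : b ∉ s) (h : IsSYT s' τ)
    (hτ : τ b = s.card + 1) {i : ℕ} (hi : 1 ≤ i) (his : i + 1 ≤ s.card) :
    IsSYT s' (swapS τ i) ↔ IsSYT s (swapS (eraseBox b τ) i) := by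
  have hswap : swapS τ i b = s.card + 1 := (swapS_eq_iff τ (by omega) b).2 hτ
  have hbs' : b ∈ s' := hs' ▸ Finset.mem_insert_self b s
  have hsub : ∀ c ∈ s, c ∈ s' := fun c hc => hs' ▸ Finset.mem_insert_of_mem hc
  have hle : ∀ c ∈ s', τ c ≤ τ b := fun c hc => by
    rw [hτ, ← Finset.card_insert_of_notMem hb, ← hs']
    exact (h.label_mem hc).2
  rw [← eraseBox_swapS b τ hi]
  refine ⟨fun h' => h'.eraseBox hs' hb hswap, fun h' => h'.of_eraseBox hs' hb ?_ ?_ hswap⟩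
  · intro hc
    exact (h.2.1 b hbs' _ (hsub _ hc) rfl rfl).not_ge (hle _ (hsub _ hc))
  · intro hc
    exact (h.2.2.1 b hbs' _ (hsub _ hc) rfl rfl).not_ge (hle _ (hsub _ hc))

theorem theBoxS_eraseBox (hs' : s' = insert b s) (hb : b ∉ s) (h : IsSYT s' τ)
    (hτ : τ b = s.card + 1) {j : ℕ} (hj : 1 ≤ j) (hjs : j ≤ s.card) :
    theBoxS s' τ j = theBoxS s (eraseBox b τ) j := by
  have h' := h.eraseBox hs' hb hτ
  obtain ⟨c, ⟨hc, rfl⟩, -⟩ := h'.1 j hj hjs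
  have hne : c ≠ b := fun hcb => hb (hcb ▸ hc)
  rw [h'.theBoxS_label hc, eraseBox_of_ne τ hne]
  exact h.theBoxS_label (hs' ▸ Finset.mem_insert_of_mem hc)

end InsertBox

theorem hatCells_succ {μ : YoungDiagram} {n : ℕ} (hn : μ.card ≤ n) :
    hatCells μ (n + 1) = insert (0, n - μ.card) (hatCells μ n) := by
  rw [hatCells, hatCells, Nat.succ_sub hn, Finset.range_add_one, Finset.image_insert,
    Finset.insert_union]

theorem notMem_hatCells (μ : YoungDiagram) (n : ℕ) : (0, n - μ.card) ∉ hatCells μ n := by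
  simp [hatCells]

theorem card_hatCells {μ : YoungDiagram} {n : ℕ} (hn : μ.card ≤ n) :
    (hatCells μ n).card = n := by
  rw [hatCells, Finset.card_union_of_disjoint, Finset.card_image_of_injective,
    Finset.card_image_of_injective, Finset.card_range]
  · exact Nat.sub_add_cancel hn
  · rintro ⟨a, b⟩ ⟨c, d⟩ h
    simpa using h
  · intro a b h
    simpa using h
  · rw [Finset.disjoint_left]
    intro c hc hc'
    obtain ⟨j, -, rfl⟩ := Finset.mem_image.1 hc
    obtain ⟨d, -, hd⟩ := Finset.mem_image.1 hc'
    simp at hd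

theorem qmap_single (μ : YoungDiagram) (n : ℕ) (τ : SYTt (hatCells μ (n + 1))) (a : Qt) :
    qmap μ n (Finsupp.single τ a) = a • qact μ n τ := by
  simp [qmap]

theorem heckeT_single (s : Finset (ℕ × ℕ)) (i : ℕ) (τ : SYTt s) (a : Qt) :
    heckeT s i (Finsupp.single τ a) = a • Tact s i τ := by
  simp [heckeT]

theorem qact_of_ne {μ : YoungDiagram} {n : ℕ} {τ : SYTt (hatCells μ (n + 1))}
    (hτ : τ.1 (0, n - μ.card) ≠ n + 1) : qact μ n τ = 0 :=
  if_neg hτ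

theorem qact_of_eq {μ : YoungDiagram} {n : ℕ} {τ : SYTt (hatCells μ (n + 1))}
    (hτ : τ.1 (0, n - μ.card) = n + 1)
    (h : IsSYT (hatCells μ n) (eraseBox (0, n - μ.card) τ.1)) :
    qact μ n τ = Finsupp.single (⟨eraseBox (0, n - μ.card) τ.1, h⟩ : SYTt (hatCells μ n)) 1 := by
  rw [qact, if_pos hτ]
  exact dif_pos h

theorem qmap_Tact {μ : YoungDiagram} {n i : ℕ} (hn : μ.card ≤ n) (hi : 1 ≤ i)
    (hin : i + 1 ≤ n) (τ : SYTt (hatCells μ (n + 1))) :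
    qmap μ n (Tact (hatCells μ (n + 1)) i τ) = heckeT (hatCells μ n) i (qact μ n τ) := by
  have hs' := hatCells_succ hn
  have hb := notMem_hatCells μ n
  have hcard := card_hatCells hn
  by_cases hτ : τ.1 (0, n - μ.card) = n + 1
  · have hτ' : τ.1 (0, n - μ.card) = (hatCells μ n).card + 1 := by rw [hτ, hcard]
    have h := τ.2.eraseBox hs' hb hτ'
    have hiff := isSYT_swapS_iff_eraseBox hs' hb τ.2 hτ' hi (by omega)
    have hqswap : ∀ hsw : IsSYT (hatCells μ (n + 1)) (swapS τ.1 i),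
        qact μ n ⟨swapS τ.1 i, hsw⟩ =
          Finsupp.single ⟨swapS (eraseBox (0, n - μ.card) τ.1) i, hiff.1 hsw⟩ 1 := by
      intro hsw
      rw [qact_of_eq ((swapS_eq_iff τ.1 (by omega) _).2 hτ)
        (by rw [eraseBox_swapS _ _ hi]; exact hiff.1 hsw)]
      congr 2
      exact eraseBox_swapS _ _ hi
    rw [qact_of_eq hτ h, heckeT_single, one_smul]
    simp only [Tact, theBoxS_eraseBox hs' hb τ.2 hτ' hi (by omega : i ≤ _),
      theBoxS_eraseBox hs' hb τ.2 hτ' (by omega : 1 ≤ i + 1) (by omega : i + 1 ≤ _)]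
    by_cases hsw : IsSYT (hatCells μ (n + 1)) (swapS τ.1 i)
    · rw [dif_pos hsw, dif_pos (hiff.1 hsw)]
      split_ifs <;>
        simp only [map_add, qmap_single, qact_of_eq hτ h, hqswap hsw, Finsupp.smul_single,
          smul_eq_mul, mul_one]
    · rw [dif_neg hsw, dif_neg (fun h' => hsw (hiff.2 h'))]
      split_ifs <;>
        simp only [map_zero, qmap_single, qact_of_eq hτ h, Finsupp.smul_single,
          smul_eq_mul, mul_one]
  · have hqswap : ∀ hsw : IsSYT (hatCells μ (n + 1)) (swapS τ.1 i),
        qact μ n ⟨swapS τ.1 i, hsw⟩ = 0 := fun hsw =>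
      qact_of_ne (fun h => hτ ((swapS_eq_iff τ.1 (by omega) _).1 h))
    rw [qact_of_ne hτ, map_zero, Tact]
    split_ifs <;> simp [qmap_single, qact_of_ne hτ, hqswap]

/-- Let `λ` be a partition and `n ≥ n_λ = |λ| + λ₁`. Then the map
`𝔮 : V_{λ^{(n+1)}} → V_{λ^{(n)}}` intertwines the seminormal operators:
`𝔮 ∘ T_i = T_i ∘ 𝔮` for all `1 ≤ i ≤ n − 1`. -/
theorem statement3 (μ : YoungDiagram) (n : ℕ) (hm : μ.card + μ.rowLen 0 ≤ n) :
    ∀ i, 1 ≤ i → i + 1 ≤ n →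
      (qmap μ n).comp (heckeT (hatCells μ (n + 1)) i) =
        (heckeT (hatCells μ n) i).comp (qmap μ n) := by
  intro i hi hin
  apply Finsupp.lhom_ext
  intro τ a
  rw [LinearMap.comp_apply, LinearMap.comp_apply, heckeT_single, qmap_single, map_smul, map_smul,
    qmap_Tact (by omega) hi hin]
end

section
/- Let λ be a partition of n and T, T' ∈ RSSYT(λ) with T ↑ T', differing at the box □_0, and let τ ∈ PSYT(λ;T) satisfy Ψ(τ) ∈ PSYT(λ;T'). Then: (i) Inv(τ) is the disjoint union of {(□_1,□_2) ∈ Inv(τ) : □_0 ∉ {□_1,□_2}} and {(□, □_0) : □ <_T □_0}; (ii) Inv(Ψ(τ)) is the disjoint union of {(□_1,□_2) ∈ Inv(Ψ(τ)) : □_0 ∉ {□_1,□_2}} and {(□_0, □) : □_0 <_{T'} □}; (iii) {(□_1,□_2) ∈ Inv(τ) : □_0 ∉ {□_1,□_2}} = {(□_1,□_2) ∈ Inv(Ψ(τ)) : □_0 ∉ {□_1,□_2}}. -/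
open scoped Classical

/-- The order on the formal labels `j·q^b` (encoded as pairs `(j, b)`):
`j·q^m < k·q^ℓ` iff `m > ℓ`, or `m = ℓ` and `j < k`. -/
def labelLT (x y : ℕ × ℕ) : Prop := y.2 < x.2 ∨ (x.2 = y.2 ∧ x.1 < y.1)

/-- `τ` is a (non-negative) periodic standard Young tableau on the finite cell set `s`
(a labelling of the boxes by symbols `j·q^b`, encoded as pairs `(j, b)`): each number
`1 ≤ j ≤ s.card` occurs in exactly one box, the labels strictly increase along rows and
columns, and `τ` is normalized to `(0, 0)` off `s`. -/
def IsPSYT (s : Finset (ℕ × ℕ)) (τ : ℕ × ℕ → ℕ × ℕ) : Prop :=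
  (∀ j, 1 ≤ j → j ≤ s.card → ∃! c, c ∈ s ∧ (τ c).1 = j) ∧
  (∀ c ∈ s, ∀ c' ∈ s, c.1 = c'.1 → c.2 + 1 = c'.2 → labelLT (τ c) (τ c')) ∧
  (∀ c ∈ s, ∀ c' ∈ s, c.1 + 1 = c'.1 → c.2 = c'.2 → labelLT (τ c) (τ c')) ∧
  (∀ c, c ∉ s → τ c = (0, 0))

/-- `T` is a non-negative reverse Young tableau on `s`: entries weakly decrease along rows
and down columns (normalized to `0` off `s`). -/
def IsRYT (s : Finset (ℕ × ℕ)) (T : ℕ × ℕ → ℕ) : Prop :=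
  (∀ c ∈ s, ∀ c' ∈ s, c.1 = c'.1 → c.2 + 1 = c'.2 → T c' ≤ T c) ∧
  (∀ c ∈ s, ∀ c' ∈ s, c.1 + 1 = c'.1 → c.2 = c'.2 → T c' ≤ T c) ∧
  (∀ c, c ∉ s → T c = 0)

/-- `T` is a non-negative reverse semi-standard Young tableau on `s`: entries weakly
decrease along rows and strictly decrease down columns (normalized to `0` off `s`). -/
def IsRSSYT (s : Finset (ℕ × ℕ)) (T : ℕ × ℕ → ℕ) : Prop :=
  (∀ c ∈ s, ∀ c' ∈ s, c.1 = c'.1 → c.2 + 1 = c'.2 → T c' ≤ T c) ∧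
  (∀ c ∈ s, ∀ c' ∈ s, c.1 + 1 = c'.1 → c.2 = c'.2 → T c' < T c) ∧
  (∀ c, c ∉ s → T c = 0)

/-- `τ ∈ PSYT(λ; T)`: a periodic standard Young tableau whose `q`-exponents are given
by `T`. -/
def InFiber (s : Finset (ℕ × ℕ)) (T : ℕ × ℕ → ℕ) (τ : ℕ × ℕ → ℕ × ℕ) : Prop :=
  IsPSYT s τ ∧ ∀ c ∈ s, (τ c).2 = T c

/-- Column-standard reading order on boxes: columns left to right, each column top to
bottom. -/
def colReadLT (c c' : ℕ × ℕ) : Prop := c.2 < c'.2 ∨ (c.2 = c'.2 ∧ c.1 < c'.1)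

/-- Row-standard reading order on boxes: rows top to bottom, left to right in each row. -/
def rowReadLT (c c' : ℕ × ℕ) : Prop := c.1 < c'.1 ∨ (c.1 = c'.1 ∧ c.2 < c'.2)

/-- The box order `□ <_T □'`: `T □ > T □'`, or `T □ = T □'` and `□` precedes `□'` in the
column-standard reading order. -/
def boxLT (T : ℕ × ℕ → ℕ) (c c' : ℕ × ℕ) : Prop :=
  T c' < T c ∨ (T c = T c' ∧ colReadLT c c')

/-- The set `Inv(τ)` of inversion pairs of `τ` (with `q`-exponents `T`): ordered pairs of
boxes `(□₁, □₂)` with `□₁ <_T □₂` whose number labels are in decreasing order. -/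
noncomputable def invSet (s : Finset (ℕ × ℕ)) (T : ℕ × ℕ → ℕ) (τ : ℕ × ℕ → ℕ × ℕ) :
    Finset ((ℕ × ℕ) × (ℕ × ℕ)) :=
  (s ×ˢ s).filter fun p => boxLT T p.1 p.2 ∧ (τ p.2).1 < (τ p.1).1

/-- `inv(τ) = |Inv(τ)|`. -/
noncomputable def invNum (s : Finset (ℕ × ℕ)) (T : ℕ × ℕ → ℕ) (τ : ℕ × ℕ → ℕ × ℕ) : ℕ :=
  (invSet s T τ).card

/-- The auxiliary reading order used to define `Min(T)`: boxes with smaller `T`-value come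
first, boxes of equal `T`-value in row-standard reading order. -/
def minOrd (T : ℕ × ℕ → ℕ) (c c' : ℕ × ℕ) : Prop :=
  T c < T c' ∨ (T c = T c' ∧ rowReadLT c c')

/-- The tableau `Min(T) ∈ PSYT(λ;T)`: `q`-exponents given by `T`, numbers `1, …, n`
assigned so that boxes with larger `T`-value receive larger numbers, boxes of equal
`T`-value being numbered consecutively in row-standard reading order. -/
noncomputable def minTab (s : Finset (ℕ × ℕ)) (T : ℕ × ℕ → ℕ) : ℕ × ℕ → ℕ × ℕ :=
  fun c => if c ∈ s then ((s.filter fun c' => minOrd T c' c).card + 1, T c) else (0, 0)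

/-- The labelling obtained from `T` by raising the value of the box `c0` by one. -/
def raiseAt (T : ℕ × ℕ → ℕ) (c0 : ℕ × ℕ) : ℕ × ℕ → ℕ :=
  fun c => if c = c0 then T c + 1 else T c

/-- The operation `Ψ`: each label `k·q^a` with `k ≥ 2` becomes `(k-1)·q^a`, and the label
`1·q^a` becomes `n·q^(a+1)`. -/
def psiTab (s : Finset (ℕ × ℕ)) (τ : ℕ × ℕ → ℕ × ℕ) : ℕ × ℕ → ℕ × ℕ :=
  fun c => if c ∈ s then
    (if (τ c).1 = 1 then (s.card, (τ c).2 + 1) else ((τ c).1 - 1, (τ c).2))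
  else (0, 0)

/-- The number labels of a periodic standard Young tableau on `s` lie in `{1, …, |s|}`. -/
theorem IsPSYT.label_mem_Icc {s : Finset (ℕ × ℕ)} {τ : ℕ × ℕ → ℕ × ℕ} (h : IsPSYT s τ)
    {c : ℕ × ℕ} (hc : c ∈ s) : 1 ≤ (τ c).1 ∧ (τ c).1 ≤ s.card := by
  have hsub : Finset.Icc 1 s.card ⊆ s.image fun c => (τ c).1 := by
    intro j hj
    obtain ⟨hj₁, hj₂⟩ := Finset.mem_Icc.1 hj
    obtain ⟨d, hd, -⟩ := h.1 j hj₁ hj₂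
    exact Finset.mem_image.2 ⟨d, hd⟩
  have heq := Finset.eq_of_subset_of_card_le hsub (by simpa using Finset.card_image_le)
  rw [← Finset.mem_Icc, heq]
  exact Finset.mem_image_of_mem _ hc

/-- If `Ψ` raises the `q`-exponents of `τ` at the box `c0` only, then `c0` is the box of `τ`
with number label `1`. -/
theorem label_eq_one_iff_of_psiTab {s : Finset (ℕ × ℕ)} {T : ℕ × ℕ → ℕ}
    {τ : ℕ × ℕ → ℕ × ℕ} {c0 : ℕ × ℕ} (hτ : InFiber s T τ)
    (hψτ : InFiber s (raiseAt T c0) (psiTab s τ)) {c : ℕ × ℕ} (hc : c ∈ s) :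
    (τ c).1 = 1 ↔ c = c0 := by
  have h₁ := hτ.2 c hc
  have h₂ := hψτ.2 c hc
  simp only [psiTab, raiseAt, if_pos hc] at h₂
  split_ifs at h₂ <;> simp_all

theorem boxLT_irrefl (T : ℕ × ℕ → ℕ) (c : ℕ × ℕ) : ¬ boxLT T c c := by
  simp [boxLT, colReadLT]

/-- Raising `T` at `c0` does not affect the comparison of boxes other than `c0`. -/
theorem boxLT_raiseAt_iff {T : ℕ × ℕ → ℕ} {c0 c d : ℕ × ℕ} (hc : c ≠ c0) (hd : d ≠ c0) :
    boxLT (raiseAt T c0) c d ↔ boxLT T c d := by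
  simp [boxLT, raiseAt, hc, hd]

/-- Let `λ` be a partition of `n` and `T, T' ∈ RSSYT(λ)` with `T ↑ T'`,
differing at the box `□₀`, and let `τ ∈ PSYT(λ;T)` satisfy `Ψ(τ) ∈ PSYT(λ;T')`. Then:
(i) `Inv(τ)` is the disjoint union of its pairs avoiding `□₀` and `{(□, □₀) : □ <_T □₀}`;
(ii) `Inv(Ψ(τ))` is the disjoint union of its pairs avoiding `□₀` and
`{(□₀, □) : □₀ <_{T'} □}`; (iii) the pairs of `Inv(τ)` avoiding `□₀` coincide with the
pairs of `Inv(Ψ(τ))` avoiding `□₀`. -/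
theorem statement11 (μ : YoungDiagram) (n : ℕ) (hn : μ.card = n)
    (T T' : ℕ × ℕ → ℕ) (hT : IsRSSYT μ.cells T) (hT' : IsRSSYT μ.cells T')
    (c0 : ℕ × ℕ) (hc0 : c0 ∈ μ.cells) (hTT' : T' = raiseAt T c0)
    (τ : ℕ × ℕ → ℕ × ℕ) (hτ : InFiber μ.cells T τ)
    (hψτ : InFiber μ.cells T' (psiTab μ.cells τ)) :
    -- (i)
    (invSet μ.cells T τ =
      ((invSet μ.cells T τ).filter fun p => p.1 ≠ c0 ∧ p.2 ≠ c0) ∪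
        ((μ.cells.filter fun c => boxLT T c c0).image fun c => (c, c0)) ∧
      Disjoint ((invSet μ.cells T τ).filter fun p => p.1 ≠ c0 ∧ p.2 ≠ c0)
        ((μ.cells.filter fun c => boxLT T c c0).image fun c => (c, c0))) ∧
    -- (ii)
    (invSet μ.cells T' (psiTab μ.cells τ) =
      ((invSet μ.cells T' (psiTab μ.cells τ)).filter fun p => p.1 ≠ c0 ∧ p.2 ≠ c0) ∪
        ((μ.cells.filter fun c => boxLT T' c0 c).image fun c => (c0, c)) ∧
      Disjoint ((invSet μ.cells T' (psiTab μ.cells τ)).filter fun p => p.1 ≠ c0 ∧ p.2 ≠ c0)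
        ((μ.cells.filter fun c => boxLT T' c0 c).image fun c => (c0, c))) ∧
    -- (iii)
    ((invSet μ.cells T τ).filter (fun p => p.1 ≠ c0 ∧ p.2 ≠ c0) =
      (invSet μ.cells T' (psiTab μ.cells τ)).filter fun p => p.1 ≠ c0 ∧ p.2 ≠ c0) := by
  subst hTT'
  have hrange : ∀ c ∈ μ.cells, 1 ≤ (τ c).1 ∧ (τ c).1 ≤ μ.cells.card :=
    fun c hc => hτ.1.label_mem_Icc hc
  have hone : ∀ c ∈ μ.cells, ((τ c).1 = 1 ↔ c = c0) :=
    fun c hc => label_eq_one_iff_of_psiTab hτ hψτ hc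
  have hτ0 : (τ c0).1 = 1 := (hone c0 hc0).2 rfl
  have hψ0 : (psiTab μ.cells τ c0).1 = μ.cells.card := by
    simp [psiTab, hc0, hτ0]
  have hψ : ∀ c ∈ μ.cells, c ≠ c0 → (psiTab μ.cells τ c).1 + 1 = (τ c).1 := by
    intro c hc hne
    have h₁ := mt (hone c hc).1 hne
    have h₂ := hrange c hc
    simp only [psiTab, if_pos hc, if_neg h₁]
    omega
  have hψle : ∀ c ∈ μ.cells, (psiTab μ.cells τ c).1 ≤ μ.cells.card :=
    fun c hc => (hψτ.1.label_mem_Icc hc).2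
  refine ⟨⟨?_, ?_⟩, ⟨?_, ?_⟩, ?_⟩
  · ext ⟨a, b⟩
    simp only [invSet, Finset.mem_union, Finset.mem_filter, Finset.mem_product,
      Finset.mem_image, Prod.mk.injEq]
    constructor
    · rintro ⟨⟨ha, hb⟩, hlt, hlab⟩
      by_cases hb0 : b = c0
      · exact Or.inr ⟨a, ⟨ha, hb0 ▸ hlt⟩, rfl, hb0.symm⟩
      · refine Or.inl ⟨⟨⟨ha, hb⟩, hlt, hlab⟩, ?_, hb0⟩
        rintro rfl
        have := (hrange b hb).1
        omega
    · rintro (⟨h, -⟩ | ⟨c, ⟨hc, hlt⟩, rfl, rfl⟩)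
      · exact h
      · refine ⟨⟨hc, hc0⟩, hlt, ?_⟩
        have hne : c ≠ c0 := fun h => boxLT_irrefl T c0 (h ▸ hlt)
        have h₁ := mt (hone c hc).1 hne
        have h₂ := (hrange c hc).1
        omega
  · rw [Finset.disjoint_left]
    intro p hp hq
    obtain ⟨c, -, rfl⟩ := Finset.mem_image.1 hq
    exact (Finset.mem_filter.1 hp).2.2 rfl
  · ext ⟨a, b⟩
    simp only [invSet, Finset.mem_union, Finset.mem_filter, Finset.mem_product,
      Finset.mem_image, Prod.mk.injEq]
    constructor
    · rintro ⟨⟨ha, hb⟩, hlt, hlab⟩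
      by_cases ha0 : a = c0
      · exact Or.inr ⟨b, ⟨hb, ha0 ▸ hlt⟩, ha0.symm, rfl⟩
      · refine Or.inl ⟨⟨⟨ha, hb⟩, hlt, hlab⟩, ha0, ?_⟩
        rintro rfl
        have := hψle a ha
        omega
    · rintro (⟨h, -⟩ | ⟨c, ⟨hc, hlt⟩, rfl, rfl⟩)
      · exact h
      · refine ⟨⟨hc0, hc⟩, hlt, ?_⟩
        have hne : c ≠ c0 := fun h => boxLT_irrefl _ c0 (h ▸ hlt)
        have h₁ := hψ c hc hne
        have h₂ := (hrange c hc).2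
        omega
  · rw [Finset.disjoint_left]
    intro p hp hq
    obtain ⟨c, -, rfl⟩ := Finset.mem_image.1 hq
    exact (Finset.mem_filter.1 hp).2.1 rfl
  · ext ⟨a, b⟩
    simp only [invSet, Finset.mem_filter, Finset.mem_product]
    refine and_congr_left fun ⟨ha0, hb0⟩ => and_congr_right fun ⟨ha, hb⟩ => ?_
    rw [boxLT_raiseAt_iff ha0 hb0, ← hψ a ha ha0, ← hψ b hb hb0, Nat.add_lt_add_iff_right]
end
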